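/- arXiv:1612.04034 — 4 statements merged into one kernel-verified Lean document; each statement's English description precedes it below -/
import Mathlib

section
/- Let a = (a_1,…,a_m) be a family of positive integers and let n ≥ 1. Then there exist a polynomial P with rational coefficients of degree exactly n and a natural number N such that for every integer k > N, the number of n-element independent sets of the graph F(a,k) equals P(k). -/
/-- The number of `n`-element independent sets of a simple graph `G`. -/
noncomputable def indepCount {V : Type*} (G : SimpleGraph V) (n : ℕ) : ℕ :=
  Set.ncard {S : Finset V | S.card = n ∧ ∀ u ∈ S, ∀ v ∈ S, ¬ G.Adj u v}

/-- The circulant-type graph `F(a,k)` on vertex set `ℤ/kℤ` with `i ~ j` (for `i ≠ j`)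
iff `i - j ≡ a_r (mod k)` or `j - i ≡ a_r (mod k)` for some `r`. -/
def graphF {m : ℕ} (a : Fin m → ℕ) (k : ℕ) : SimpleGraph (ZMod k) :=
  SimpleGraph.fromRel (fun i j => ∃ r : Fin m, i - j = (a r : ZMod k))

def Good {V : Type} (L : List (V × V × ℤ)) (k : ℕ) (f : V → ZMod k) : Prop :=
  ∀ t ∈ L, f t.1 - f t.2.1 ≠ (t.2.2 : ZMod k)

open Polynomial in
theorem count_poly (n : ℕ) : ∀ (V : Type) [Fintype V] [DecidableEq V], Fintype.card V = n →
    ∀ L : List (V × V × ℤ), ∃ (P : Polynomial ℚ) (N : ℕ), P.natDegree ≤ n ∧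
      ((∀ t ∈ L, t.1 ≠ t.2.1) → P.coeff n = 1) ∧
      ∀ k : ℕ, N < k → (Nat.card {f : V → ZMod k // Good L k f} : ℚ) = P.eval (k : ℚ) := by
  induction n with
  | zero =>
    intro V _ _ hV L
    have hE : IsEmpty V := Fintype.card_eq_zero_iff.mp hV
    refine ⟨1, 0, by simp, by simp, ?_⟩
    intro k hk
    have : Unique {f : V → ZMod k // Good L k f} :=
      { default := ⟨fun v => hE.elim v, fun t _ => hE.elim t.1⟩
        uniq := fun f => Subtype.ext (funext fun v => hE.elim v) }
    simp
  | succ n ih =>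
    intro V _ _ hV L
    induction L with
    | nil =>
      refine ⟨X ^ (n+1), 0, by simp, by simp, ?_⟩
      intro k hk
      have : NeZero k := ⟨by omega⟩
      have e : {f : V → ZMod k // Good [] k f} ≃ (V → ZMod k) :=
        Equiv.subtypeUnivEquiv (fun f t ht => by simp at ht)
      rw [Nat.card_congr e]
      simp [hV, ZMod.card]
    | cons t L ihL =>
      obtain ⟨i, j, d⟩ := t
      obtain ⟨P, N, hP1, hP2, hP3⟩ := ihL
      by_cases hij : i = j
      · subst hij
        by_cases hd : d = 0
        · subst hd
          refine ⟨0, 0, by simp, ?_, ?_⟩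
          · intro h
            exact absurd rfl (h (i, i, 0) (by simp))
          · intro k hk
            have : IsEmpty {f : V → ZMod k // Good ((i, i, 0) :: L) k f} :=
              ⟨fun f => f.2 (i, i, 0) (by simp) (by simp)⟩
            simp
        · refine ⟨P, max N d.natAbs, hP1, ?_, ?_⟩
          · intro h
            exact absurd rfl (h (i, i, d) (by simp))
          · intro k hk
            rw [← hP3 k (by omega)]
            have hd0 : (d : ZMod k) ≠ 0 := by
              intro h0
              have : NeZero k := ⟨by omega⟩
              have h1 := (ZMod.intCast_zmod_eq_zero_iff_dvd d k).mp h0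
              have h2 := Int.natAbs_dvd_natAbs.mpr h1
              have h3 := Nat.le_of_dvd (by omega) h2
              simp at h3
              omega
            congr 1
            apply Nat.card_congr
            apply Equiv.subtypeEquivRight
            intro f
            simp [Good, hd0.symm]
      · let s : V → ℤ := fun v => if v = i then d else 0
        let p : V → {v : V // v ≠ i} := fun v => if h : v = i then ⟨j, Ne.symm hij⟩ else ⟨v, h⟩
        let L' : List ({v : V // v ≠ i} × {v : V // v ≠ i} × ℤ) :=
          L.map (fun t => (p t.1, p t.2.1, t.2.2 - s t.1 + s t.2.1))
        obtain ⟨Q, M, hQ1, hQ2, hQ3⟩ := ih {v : V // v ≠ i} (by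
          simp [hV]) L'
        refine ⟨P - Q, max N M, ?_, ?_, ?_⟩
        · exact (natDegree_sub_le _ _).trans (by omega)
        · intro h
          rw [coeff_sub, hP2 (fun t ht => h t (by simp [ht])),
            coeff_eq_zero_of_natDegree_lt (by omega)]
          simp
        · intro k hk
          have : NeZero k := ⟨by omega⟩
          rw [eval_sub, ← hP3 k (by omega), ← hQ3 k (by omega), eq_sub_iff_add_eq]
          norm_cast
          classical
          have e1 : {f : {v : V // v ≠ i} → ZMod k // Good L' k f} ≃
              {f : V → ZMod k // Good L k f ∧ f i - f j = (d : ZMod k)} :=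
            { toFun := fun g => ⟨fun v => g.1 (p v) + (s v : ZMod k), by
                constructor
                · intro t ht h
                  apply g.2 (p t.1, p t.2.1, t.2.2 - s t.1 + s t.2.1)
                    (List.mem_map.mpr ⟨t, ht, rfl⟩)
                  push_cast
                  rw [← h]
                  ring
                · simp [p, s, Ne.symm hij]⟩
              invFun := fun f => ⟨fun v => f.1 v.1, by
                have key : ∀ v, f.1 v = f.1 (p v).1 + (s v : ZMod k) := by
                  intro v
                  by_cases hv : v = i
                  · subst hv
                    simp [p, s, ← f.2.2]
                  · simp [p, s, hv]
                intro t ht h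
                obtain ⟨u, hu, rfl⟩ := List.mem_map.mp ht
                apply f.2.1 u hu
                rw [key u.1, key u.2.1]
                push_cast at h
                linear_combination h⟩
              left_inv := by
                intro g
                apply Subtype.ext
                funext v
                simp [p, s, v.2]
              right_inv := by
                intro f
                apply Subtype.ext
                funext v
                by_cases hv : v = i
                · subst hv
                  simp [p, s, ← f.2.2]
                · simp [p, s, hv] }
          rw [Nat.card_congr e1, Nat.card_eq_fintype_card, Nat.card_eq_fintype_card,
            Nat.card_eq_fintype_card, Fintype.card_subtype, Fintype.card_subtype,
            Fintype.card_subtype,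
            ← Finset.card_filter_add_card_filter_not (s := Finset.univ.filter (Good L k))
              (fun f : V → ZMod k => f i - f j = (d : ZMod k)), add_comm,
            Finset.filter_filter, Finset.filter_filter]
          congr 3
          ext f
          simp [Good, and_comm]

theorem indep_fact (k n : ℕ) [NeZero k] (G : SimpleGraph (ZMod k)) :
    indepCount G n * n.factorial =
      Nat.card {f : Fin n → ZMod k // Function.Injective f ∧ ∀ i j, ¬ G.Adj (f i) (f j)} := by
  classical
  let A := {S : Finset (ZMod k) // S.card = n ∧ ∀ u ∈ S, ∀ v ∈ S, ¬ G.Adj u v}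
  let F : (Σ S : A, (Fin n ≃ S.1)) →
      {f : Fin n → ZMod k // Function.Injective f ∧ ∀ i j, ¬ G.Adj (f i) (f j)} :=
    fun x => ⟨fun i => (x.2 i : ZMod k),
      fun i j h => x.2.injective (Subtype.ext h),
      fun i j => x.1.2.2 _ (x.2 i).2 _ (x.2 j).2⟩
  have hF : Function.Bijective F := by
    constructor
    · rintro ⟨⟨S, hS⟩, e⟩ ⟨⟨T, hT⟩, e'⟩ h
      have h1 : ∀ i, (e i : ZMod k) = e' i := fun i => congrFun (congrArg Subtype.val h) i
      have hST : S = T := by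
        ext x
        constructor
        · intro hx
          obtain ⟨i, hi⟩ := e.surjective ⟨x, hx⟩
          have := h1 i
          rw [hi] at this
          simp only at this
          rw [this]
          exact (e' i).2
        · intro hx
          obtain ⟨i, hi⟩ := e'.surjective ⟨x, hx⟩
          have := h1 i
          rw [hi] at this
          simp only at this
          rw [← this]
          exact (e i).2
      subst hST
      have : e = e' := Equiv.ext fun i => Subtype.ext (h1 i)
      subst this
      rfl
    · rintro ⟨f, hf, hG⟩
      refine ⟨⟨⟨Finset.univ.image f, ?_, ?_⟩, Equiv.ofBijective
        (fun i => ⟨f i, Finset.mem_image_of_mem _ (Finset.mem_univ i)⟩) ⟨?_, ?_⟩⟩, ?_⟩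
      · rw [Finset.card_image_of_injective _ hf]; simp
      · intro u hu v hv
        simp only [Finset.mem_image, Finset.mem_univ, true_and] at hu hv
        obtain ⟨i, rfl⟩ := hu
        obtain ⟨j, rfl⟩ := hv
        exact hG i j
      · intro i j h
        exact hf (congrArg Subtype.val h)
      · rintro ⟨x, hx⟩
        simp only [Finset.mem_image, Finset.mem_univ, true_and] at hx
        obtain ⟨i, rfl⟩ := hx
        exact ⟨i, rfl⟩
      · rfl
  rw [← Nat.card_eq_of_bijective F hF, Nat.card_sigma]
  have h2 : ∀ S : A, Nat.card (Fin n ≃ S.1) = n.factorial := by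
    intro S
    have e : Fin n ≃ S.1 := Fintype.equivOfCardEq (by simp [S.2.1])
    rw [Nat.card_eq_fintype_card, Fintype.card_equiv e, Fintype.card_fin]
  simp only [h2, Finset.sum_const, smul_eq_mul, Finset.card_univ]
  congr 1
  rw [← Nat.card_eq_fintype_card]
  rfl

theorem stmt_6 (m n : ℕ) (hn : 1 ≤ n) (a : Fin m → ℕ) (hapos : ∀ r, 0 < a r) :
    ∃ (P : Polynomial ℚ) (N : ℕ), P.degree = n ∧
      ∀ k : ℕ, N < k → (indepCount (graphF a k) n : ℚ) = P.eval (k : ℚ) := by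
  classical
  let D : List ℤ := 0 :: (List.finRange m).map (fun r => (a r : ℤ))
  let L : List (Fin n × Fin n × ℤ) :=
    ((((List.finRange n).product ((List.finRange n).product D)))).filter (fun t => t.1 ≠ t.2.1)
  obtain ⟨P, N, h1, h2, h3⟩ := count_poly n (Fin n) (by simp) L
  have hc : P.coeff n = 1 := h2 (by
    intro t ht
    simpa using (List.mem_filter.mp ht).2)
  have hfac : (n.factorial : ℚ) ≠ 0 := by exact_mod_cast n.factorial_ne_zero
  refine ⟨Polynomial.C ((n.factorial : ℚ)⁻¹) * P, N, ?_, ?_⟩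
  · rw [Polynomial.degree_C_mul (inv_ne_zero hfac)]
    apply le_antisymm
    · exact Polynomial.natDegree_le_iff_degree_le.mp h1
    · exact Polynomial.le_degree_of_ne_zero (by rw [hc]; exact one_ne_zero)
  · intro k hk
    have : NeZero k := ⟨by omega⟩
    rw [Polynomial.eval_mul, Polynomial.eval_C, ← h3 k hk, eq_inv_mul_iff_mul_eq₀ hfac, mul_comm]
    have := indep_fact k n (graphF a k)
    rw [← Nat.cast_mul, this]
    congr 1
    apply Nat.card_congr
    apply Equiv.subtypeEquivRight
    intro f
    have hL : ∀ t : Fin n × Fin n × ℤ, t ∈ L ↔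
        (t.2.2 = 0 ∨ ∃ r, (a r : ℤ) = t.2.2) ∧ t.1 ≠ t.2.1 := by
      rintro ⟨i, j, d⟩
      simp [L, D, List.mem_filter]
    constructor
    · rintro ⟨hf, hG⟩ ⟨i, j, d⟩ ht heq
      obtain ⟨hd, hij⟩ := (hL _).mp ht
      simp only at hd hij heq
      rcases hd with rfl | ⟨r, rfl⟩
      · apply hij
        apply hf
        simpa [sub_eq_zero] using heq
      · apply hG i j
        rw [graphF, SimpleGraph.fromRel_adj]
        exact ⟨fun h => hij (hf h), Or.inl ⟨r, by simpa using heq⟩⟩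
    · intro h
      refine ⟨?_, ?_⟩
      · intro i j hij
        by_contra hne
        exact h (i, j, 0) ((hL _).mpr ⟨Or.inl rfl, hne⟩) (by simp [hij])
      · intro i j hadj
        rw [graphF, SimpleGraph.fromRel_adj] at hadj
        obtain ⟨hne, ⟨r, hr⟩ | ⟨r, hr⟩⟩ := hadj
        · exact h (i, j, (a r : ℤ)) ((hL _).mpr ⟨Or.inr ⟨r, rfl⟩, fun e => hne (by simp only at e; rw [e])⟩)
            (by simpa using hr)
        · exact h (j, i, (a r : ℤ)) ((hL _).mpr ⟨Or.inr ⟨r, rfl⟩, fun e => hne (by simp only at e; rw [e])⟩)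
            (by simpa using hr)
end

section
/- Let a ≥ 2, m ≥ 1 and n ≥ 1 be integers. Then there exists N such that for every prime q > N, the number of tuples (x_1,…,x_n) ∈ (ℤ/qℤ)^n whose coordinates are all nonzero and pairwise distinct and which satisfy x_i ≠ a^r·x_j for all i ≠ j and all integers r with 1 ≤ r ≤ m, equals (q − 1) · ∏_{j=1}^{n−1} (q − 1 − m·n − j), the product being taken in the integers. -/
/-- Solutions of a list of difference constraints `x i ≠ σ^r (x j)`. -/
def Sol {X : Type} (σ : Equiv.Perm X) {n : ℕ} (L : List (Fin n × Fin n × ℤ)) :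
    Set (Fin n → X) :=
  {x | ∀ c ∈ L, x c.1 ≠ (σ ^ c.2.2) (x c.2.1)}

/-- All cycles of `σ` have length at least `K`. -/
def LongCyc {X : Type} (σ : Equiv.Perm X) (K : ℕ) : Prop :=
  ∀ k : ℤ, k ≠ 0 → k.natAbs < K → ∀ x, (σ ^ k) x ≠ x

lemma contract_ncard {X : Type} [Finite X] (σ : Equiv.Perm X) {n : ℕ}
    (L : List (Fin (n+1) × Fin (n+1) × ℤ)) (i : Fin (n+1)) (j : Fin n) (r : ℤ)
    (s : Fin (n+1) → ℤ) (t : Fin (n+1) → Fin n)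
    (hsi : s i = r) (hti : t i = j) (hs : ∀ k, s (i.succAbove k) = 0)
    (ht : ∀ k, t (i.succAbove k) = k) :
    ({x | x ∈ Sol σ L ∧ x i = (σ ^ r) (x (i.succAbove j))} : Set (Fin (n+1) → X)).ncard =
      (Sol σ (L.map fun c => (t c.1, t c.2.1, c.2.2 + s c.2.1 - s c.1))).ncard := by
  have key : ∀ y : Fin n → X, (fun k => (σ ^ s k) (y (t k))) ∈ Sol σ L ↔
      y ∈ Sol σ (L.map fun c => (t c.1, t c.2.1, c.2.2 + s c.2.1 - s c.1)) := by
    intro y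
    simp only [Sol, Set.mem_ofPred_eq, List.forall_mem_map]
    refine forall₂_congr fun c _ => ?_
    rw [not_iff_not, ← Equiv.Perm.mul_apply, ← zpow_add,
      show c.2.2 + s c.2.1 - s c.1 = -s c.1 + (c.2.2 + s c.2.1) by ring, zpow_add σ (-s c.1),
      Equiv.Perm.mul_apply, zpow_neg, Equiv.Perm.eq_inv_iff_eq]
  symm
  refine Set.ncard_congr (fun y _ => fun k => (σ ^ s k) (y (t k))) ?_ ?_ ?_
  · intro y hy
    refine ⟨(key y).2 hy, ?_⟩
    simp [hsi, hti, hs, ht]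
  · intro y y' _ _ h
    funext k
    have := congrFun h (i.succAbove k)
    simpa [hs, ht] using this
  · rintro x ⟨hx, hxi⟩
    have hxx : (fun k => (σ ^ s k) (x (i.succAbove (t k)))) = x := by
      funext k
      rcases Fin.eq_self_or_eq_succAbove i k with rfl | ⟨l, rfl⟩
      · simp [hsi, hti, hxi]
      · simp [hs, ht]
    refine ⟨fun k => x (i.succAbove k), ?_, hxx⟩
    rw [← key]
    rw [hxx]; exact hx

lemma count_indep : ∀ (n : ℕ) (L : List (Fin n × Fin n × ℤ)),
    ∃ (K : ℕ) (f : ℕ → ℕ), ∀ (X : Type) [Finite X] (σ : Equiv.Perm X), LongCyc σ K →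
      (Sol σ L).ncard = f (Nat.card X) := by
  intro n
  induction n with
  | zero =>
    intro L
    refine ⟨0, fun _ => 1, fun X _ σ _ => ?_⟩
    have : Sol σ L = Set.univ := by
      ext x
      simp only [Sol, Set.mem_ofPred_eq, Set.mem_univ, iff_true]
      intro c; exact c.1.elim0
    rw [this, Set.ncard_univ]; simp
  | succ n ihn =>
    intro L
    induction L with
    | nil =>
      refine ⟨0, fun d => d ^ (n+1), fun X _ σ _ => ?_⟩
      have : Sol σ ([] : List (Fin (n+1) × Fin (n+1) × ℤ)) = Set.univ := by
        ext x; simp [Sol]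
      rw [this, Set.ncard_univ]; simp [Nat.card_fun]
    | cons c L ih =>
      obtain ⟨i, j, r⟩ := c
      obtain ⟨K, f, hf⟩ := ih
      rcases Fin.eq_self_or_eq_succAbove i j with rfl | ⟨j, rfl⟩
      · by_cases hr : r = 0
        · refine ⟨0, fun _ => 0, fun X _ σ _ => ?_⟩
          have : Sol σ ((j, j, r) :: L) = ∅ := by
            ext x; simp [Sol, hr]
          simp [this]
        · refine ⟨max K (r.natAbs + 1), f, fun X _ σ h => ?_⟩
          rw [← hf X σ fun k hk hk' => h k hk (lt_of_lt_of_le hk' (le_max_left _ _))]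
          congr 1
          ext x
          have := h r hr (lt_of_lt_of_le (Nat.lt_succ_self _) (le_max_right _ _)) (x j)
          simp [Sol, Ne.symm this]
      · let s : Fin (n+1) → ℤ := i.insertNth (α := fun _ => ℤ) r (fun _ => 0)
        let t : Fin (n+1) → Fin n := i.insertNth (α := fun _ => Fin n) j id
        obtain ⟨K', f', hf'⟩ := ihn (L.map fun c => (t c.1, t c.2.1, c.2.2 + s c.2.1 - s c.1))
        refine ⟨max K K', fun d => f d - f' d, fun X _ σ h => ?_⟩
        have h1 := hf X σ fun k hk hk' => h k hk (lt_of_lt_of_le hk' (le_max_left _ _))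
        have h2 := hf' X σ fun k hk hk' => h k hk (lt_of_lt_of_le hk' (le_max_right _ _))
        rw [← contract_ncard σ L i j r s t (by simp [s]) (by simp [t]) (by simp [s])
          (by simp [t])] at h2
        show _ = f _ - f' _
        rw [← h1, ← h2, ← Set.ncard_sdiff (fun x hx => hx.1) (Set.toFinite _)]
        congr 1
        ext x
        simp only [Sol, List.mem_cons, forall_eq_or_imp, Set.mem_ofPred_eq, Set.mem_sdiff]
        tauto

/-- Spaced configurations on a segment. -/
def Spaced (m k D : ℕ) : Set (Fin k → ℕ) :=
  {z | (∀ i, m < z i ∧ z i + m < D) ∧ ∀ i j, i ≠ j → ∀ r ≤ m, z i ≠ z j + r}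

lemma gap_card {m k D : ℕ} {z : Fin k → ℕ} (hz : z ∈ Spaced m k D) (S : Finset (Fin k))
    (a b : ℕ) (hab : a ≤ b) (h : ∀ l ∈ S, a ≤ z l ∧ z l + m < b) :
    a + (m + 1) * S.card ≤ b := by
  have h1 : (S.biUnion fun l => Finset.Ico (z l) (z l + (m+1))).card = S.card * (m+1) := by
    rw [Finset.card_biUnion]
    · simp
    · intro u _ v _ huv
      rw [Function.onFun, Finset.disjoint_left]
      intro p hp hq
      simp only [Finset.mem_Ico] at hp hq
      rcases le_total (z u) (z v) with h | h
      · exact hz.2 v u huv.symm (z v - z u) (by omega) (by omega)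
      · exact hz.2 u v huv (z u - z v) (by omega) (by omega)
  have h2 : (S.biUnion fun l => Finset.Ico (z l) (z l + (m+1))) ⊆ Finset.Ico a b := by
    intro p hp
    simp only [Finset.mem_biUnion, Finset.mem_Ico] at hp ⊢
    obtain ⟨l, hl, hp⟩ := hp
    have := h l hl
    omega
  have h3 := Finset.card_le_card h2
  rw [h1, Nat.card_Ico, mul_comm] at h3
  omega

/-- number of smaller entries -/
def rk {k : ℕ} (z : Fin k → ℕ) (i : Fin k) : ℕ := (Finset.univ.filter fun j => z j < z i).card

lemma rk_lt {k : ℕ} (z : Fin k → ℕ) (i : Fin k) : rk z i < k := by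
  have : (Finset.univ.filter fun j => z j < z i).card < (Finset.univ : Finset (Fin k)).card := by
    apply Finset.card_lt_card
    rw [Finset.ssubset_univ_iff]
    intro h
    have := Finset.mem_univ i
    rw [← h] at this
    simp at this
  simpa [rk] using this

lemma rk_mono {k : ℕ} (z : Fin k → ℕ) (i j : Fin k) (h : z i < z j) : rk z i < rk z j := by
  apply Finset.card_lt_card
  rw [Finset.ssubset_iff_of_subset]
  · exact ⟨i, by simpa using h, by simp⟩
  · intro l hl
    simp only [Finset.mem_filter, Finset.mem_univ, true_and] at hl ⊢
    omega

lemma rk_congr {k : ℕ} (z w : Fin k → ℕ) (h : ∀ i j, z i < z j → w i < w j)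
    (hz : Function.Injective z) : rk w = rk z := by
  funext i
  unfold rk
  congr 1
  ext j
  simp only [Finset.mem_filter, Finset.mem_univ, true_and]
  constructor
  · intro hj
    by_contra hc
    rcases (not_lt.1 hc).lt_or_eq with h' | h'
    · have := h _ _ h'; omega
    · rw [hz h'] at hj; omega
  · exact h _ _

lemma spaced_ncard (m k D : ℕ) (hD : m * (k + 1) + 1 ≤ D) :
    (Spaced m k D).ncard = (D - m * (k+1) - 1).descFactorial k := by
  set M := D - m * (k+1) - 1 with hM
  have hcard : Nat.card (Fin k ↪ Fin M) = M.descFactorial k := by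
    rw [Nat.card_eq_fintype_card, Fintype.card_embedding_eq]; simp
  rw [← hcard, ← Nat.card_coe_set_eq]
  symm
  let g : (Fin k ↪ Fin M) → Fin k → ℕ := fun e i =>
    (e i : ℕ) + (m + 1) + m * rk (fun l => (e l : ℕ)) i
  have hmono : ∀ e i j, (e i : ℕ) < e j → g e i + m < g e j := by
    intro e i j h
    have := rk_mono (fun l => (e l : ℕ)) i j h
    have := Nat.mul_le_mul_left m (Nat.succ_le_of_lt this)
    simp only [g]
    rw [Nat.mul_succ] at this
    omega
  have hinj : ∀ e : Fin k ↪ Fin M, Function.Injective (fun l => (e l : ℕ)) := by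
    intro e a b h
    exact e.injective (Fin.ext h)
  have hg : ∀ e, g e ∈ Spaced m k D := by
    intro e
    refine ⟨fun i => ⟨by simp only [g]; omega, ?_⟩, ?_⟩
    · have h1 := (e i).2
      have h2 := Nat.mul_le_mul_left m (Nat.succ_le_of_lt (rk_lt (fun l => (e l : ℕ)) i))
      rw [Nat.mul_succ] at h2
      rw [Nat.mul_succ] at hM
      simp only [g]
      omega
    · intro i j hij r hr h
      have hne : (e i : ℕ) ≠ e j := fun h => hij (hinj e h)
      rcases hne.lt_or_gt with h' | h'
      · have := hmono e _ _ h'; omega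
      · have := hmono e _ _ h'; omega
  have hrk : ∀ e, rk (g e) = rk (fun l => (e l : ℕ)) := by
    intro e
    exact rk_congr _ _ (fun i j h => by have := hmono e i j h; omega) (hinj e)
  refine Nat.card_eq_of_bijective (fun e => (⟨g e, hg e⟩ : Spaced m k D)) ⟨?_, ?_⟩
  · intro e e' h
    have h : g e = g e' := congrArg Subtype.val h
    ext i
    have h1 := congrFun h i
    have h2 : rk (fun l => (e l : ℕ)) = rk (fun l => (e' l : ℕ)) := by
      rw [← hrk, ← hrk, h]
    simp only [g, h2] at h1
    omega
  · rintro ⟨z, hz⟩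
    have hzinj : Function.Injective z := by
      intro i j h
      by_contra hc
      exact hz.2 i j hc 0 (by omega) (by omega)
    have hgap : ∀ i j, z i < z j → z i + m < z j := by
      intro i j h
      by_contra hc
      exact hz.2 j i (by rintro rfl; omega) (z j - z i) (by omega) (by omega)
    have hlow : ∀ i, m + 1 + (m + 1) * rk z i ≤ z i := by
      intro i
      refine gap_card hz _ _ _ (hz.1 i).1 ?_
      intro l hl
      simp only [Finset.mem_filter, Finset.mem_univ, true_and] at hl
      exact ⟨(hz.1 l).1, hgap _ _ hl⟩
    have hup : ∀ i, z i + (m + 1) * (k - rk z i) ≤ D := by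
      intro i
      have : k - rk z i = (Finset.univ.filter fun j => z j < z i)ᶜ.card := by
        rw [Finset.card_compl]; simp [rk]
      rw [this]
      refine gap_card hz _ _ _ (by have := (hz.1 i).2; omega) ?_
      intro l hl
      simp only [Finset.mem_compl, Finset.mem_filter, Finset.mem_univ, true_and] at hl
      exact ⟨by omega, (hz.1 l).2⟩
    have hmid : ∀ i j, z i < z j → z i + (m + 1) * (rk z j - rk z i) ≤ z j := by
      intro i j hij
      have : rk z j - rk z i = ((Finset.univ.filter fun l => z l < z j) \
          (Finset.univ.filter fun l => z l < z i)).card := by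
        rw [Finset.card_sdiff_of_subset]
        · rfl
        · intro l hl
          simp only [Finset.mem_filter, Finset.mem_univ, true_and] at hl ⊢
          omega
      rw [this]
      refine gap_card hz _ _ _ hij.le ?_
      intro l hl
      simp only [Finset.mem_sdiff, Finset.mem_filter, Finset.mem_univ, true_and] at hl
      exact ⟨by omega, hgap _ _ hl.1⟩
    let w : Fin k → ℕ := fun i => z i - (m + 1) - m * rk z i
    have hw : ∀ i, w i + (m + 1) + m * rk z i = z i := by
      intro i
      have := hlow i
      rw [Nat.add_mul] at this
      simp only [w]; omega
    have hwlt : ∀ i, w i < M := by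
      intro i
      have h1 := hup i
      have h2 := hw i
      have h3 := rk_lt z i
      obtain ⟨d, hd⟩ := Nat.exists_eq_add_of_lt h3
      have h4 : k - rk z i = d + 1 := by omega
      rw [h4] at h1
      have h5 : m * (k + 1) = m * rk z i + (m * d + m) + m := by linear_combination m * hd
      have h6 : (m + 1) * (d + 1) = m * d + m + d + 1 := by ring
      omega
    have hwmono : ∀ i j, z i < z j → w i < w j := by
      intro i j h
      have h1 := hmid i j h
      obtain ⟨d, hd⟩ := Nat.exists_eq_add_of_lt (rk_mono z i j h)
      have h4 : rk z j - rk z i = d + 1 := by omega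
      rw [h4] at h1
      have h2 := hw i
      have h3 := hw j
      have h5 : m * rk z j = m * rk z i + (m * d + m) := by rw [hd]; ring
      have h6 : (m + 1) * (d + 1) = m * d + m + d + 1 := by ring
      omega
    have hwrk : rk w = rk z := rk_congr _ _ hwmono hzinj
    refine ⟨⟨fun i => ⟨w i, hwlt i⟩, ?_⟩, ?_⟩
    · intro i j h
      have h : w i = w j := congrArg Fin.val h
      by_contra hc
      rcases lt_or_gt_of_ne (fun h' => hc (hzinj h') : z i ≠ z j) with h' | h'
      · have := hwmono _ _ h'; omega
      · have := hwmono _ _ h'; omega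
    · apply Subtype.ext
      funext i
      show w i + (m + 1) + m * rk w i = z i
      rw [hwrk]; exact hw i

lemma cycle_ncard (m k D : ℕ) [NeZero D] (hD : m * (k + 1) + 1 ≤ D) :
    ({x : Fin (k+1) → ZMod D | ∀ i j, i ≠ j → ∀ r : ℕ, r ≤ m → x i ≠ x j + r}).ncard =
      D * (D - m * (k+1) - 1).descFactorial k := by
  rw [← spaced_ncard m k D hD, ← Nat.card_coe_set_eq, ← Nat.card_coe_set_eq]
  have hDc : Nat.card (ZMod D) = D := by simp
  conv_rhs => enter [1]; rw [← hDc]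
  rw [← Nat.card_prod]
  symm
  have hmD : m < D := by nlinarith
  have hcast : ∀ u v : ℕ, u < D → v < D → (u : ZMod D) = v → u = v := by
    intro u v hu hv h
    rw [ZMod.natCast_eq_natCast_iff'] at h
    rwa [Nat.mod_eq_of_lt hu, Nat.mod_eq_of_lt hv] at h
  refine Nat.card_eq_of_bijective (fun p => ⟨Fin.cons p.1 (fun i => p.1 + (p.2.1 i : ZMod D)), ?_⟩)
    ⟨?_, ?_⟩
  · obtain ⟨x0, z, hz⟩ := p
    intro i j hij r hr
    induction i using Fin.cases with
    | zero =>
      induction j using Fin.cases with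
      | zero => exact absurd rfl hij
      | succ j =>
        have := hz.1 j
        intro h
        simp only [Fin.cons_zero, Fin.cons_succ] at h
        rw [add_assoc, left_eq_add] at h
        have := hcast (z j + r) 0 (by omega) (by omega) (by push_cast; exact h)
        omega
    | succ i =>
      have hi := hz.1 i
      induction j using Fin.cases with
      | zero =>
        intro h
        simp only [Fin.cons_zero, Fin.cons_succ] at h
        have := hcast (z i) r (by omega) (by omega) (add_left_cancel h)
        omega
      | succ j =>
        have hj := hz.1 j
        intro h
        simp only [Fin.cons_succ] at h
        rw [add_assoc] at h
        have := hcast (z i) (z j + r) (by omega) (by omega)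
          (by push_cast; exact add_left_cancel h)
        exact hz.2 i j (fun h => hij (congrArg _ h)) r hr this
  · rintro ⟨x0, z, hz⟩ ⟨y0, w, hw⟩ h
    have h := congrArg Subtype.val h
    have h0 : x0 = y0 := by simpa using congrFun h 0
    subst h0
    congr
    funext i
    have hi := congrFun h i.succ
    simp only [Fin.cons_succ] at hi
    have := hz.1 i
    have := hw.1 i
    exact hcast _ _ (by omega) (by omega) (add_left_cancel hi)
  · rintro ⟨x, hx⟩
    have hv : ∀ i : Fin k, (((x i.succ - x 0).val : ℕ) : ZMod D) = x i.succ - x 0 :=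
      fun i => ZMod.natCast_zmod_val _
    refine ⟨⟨x 0, fun i => (x i.succ - x 0).val, ?_, ?_⟩, ?_⟩
    · intro i
      have hlt := ZMod.val_lt (x i.succ - x 0)
      constructor
      · by_contra hc
        refine hx i.succ 0 (Fin.succ_ne_zero i) _ (not_lt.1 hc) ?_
        rw [hv]; ring
      · by_contra hc
        simp only at hc
        refine hx 0 i.succ (Fin.succ_ne_zero i).symm (D - (x i.succ - x 0).val) (by omega) ?_
        rw [Nat.cast_sub hlt.le, hv]; simp
    · intro i j hij r hr h
      refine hx i.succ j.succ (fun h => hij (Fin.succ_injective _ h)) r hr ?_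
      have := congrArg (Nat.cast : ℕ → ZMod D) h
      push_cast at this
      rw [hv, hv] at this
      linear_combination this
    · apply Subtype.ext
      funext i
      induction i using Fin.cases with
      | zero => simp
      | succ i => simp only [Fin.cons_succ]; rw [hv]; ring

/-- The list of constraints. -/
noncomputable def cons13 (m n : ℕ) : List (Fin n × Fin n × ℤ) :=
  (((Finset.univ : Finset (Fin n × Fin n)).filter fun p => p.1 ≠ p.2) ×ˢ
    Finset.range (m+1)).toList.map fun p => (p.1.1, p.1.2, (p.2 : ℤ))

lemma mem_sol13 {X : Type} (σ : Equiv.Perm X) (m n : ℕ) (x : Fin n → X) :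
    x ∈ Sol σ (cons13 m n) ↔ ∀ i j, i ≠ j → ∀ r : ℕ, r ≤ m → x i ≠ (σ ^ r) (x j) := by
  simp only [Sol, cons13, Set.mem_ofPred_eq, List.forall_mem_map, Finset.mem_toList,
    Finset.mem_product, Finset.mem_filter, Finset.mem_univ, true_and, Finset.mem_range,
    Nat.lt_succ_iff, zpow_natCast]
  constructor
  · intro h i j hij r hr
    exact h ((i, j), r) ⟨hij, hr⟩
  · rintro h ⟨⟨i, j⟩, r⟩ ⟨hij, hr⟩
    exact h i j hij r hr

theorem stmt_13 (a m n : ℕ) (ha : 2 ≤ a) (hm : 1 ≤ m) (hn : 1 ≤ n) :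
    ∃ N : ℕ, ∀ q : ℕ, q.Prime → N < q →
      (Set.ncard {x : Fin n → ZMod q | Function.Injective x ∧ (∀ i, x i ≠ 0) ∧
          ∀ i j, i ≠ j → ∀ r : ℕ, 1 ≤ r → r ≤ m →
            x i ≠ (a : ZMod q) ^ r * x j} : ℤ) =
        ((q : ℤ) - 1) * ∏ j ∈ Finset.Icc 1 (n - 1), ((q : ℤ) - 1 - m * n - j) := by
  obtain ⟨k, rfl⟩ : ∃ k, n = k + 1 := ⟨n - 1, by omega⟩
  obtain ⟨K, f, hf⟩ := count_indep (k+1) (cons13 m (k+1))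
  refine ⟨a ^ K + K + a + m * (k + 1) + k + 2, fun q hq hN => ?_⟩
  have : Fact q.Prime := ⟨hq⟩
  have haK : 0 < a ^ K := by positivity
  have ha0 : (a : ZMod q) ≠ 0 := by
    rw [Ne, ZMod.natCast_eq_zero_iff]
    intro h
    have := Nat.le_of_dvd (by omega) h
    omega
  let u : (ZMod q)ˣ := Units.mk0 (a : ZMod q) ha0
  let σ : Equiv.Perm (ZMod q)ˣ := MulAction.toPermHom (ZMod q)ˣ (ZMod q)ˣ u
  have hσz : ∀ (z : ℤ) x, (σ ^ z) x = u ^ z * x := by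
    intro z x
    simp only [σ, ← map_zpow]; rfl
  have hσ : ∀ (r : ℕ) x, (σ ^ r) x = u ^ r * x := by
    intro r x
    simp only [σ, ← map_pow]; rfl
  have hu : ∀ r : ℕ, 0 < r → r < K → u ^ r ≠ 1 := by
    intro r h0 hr h
    have h1 : ((a ^ r : ℕ) : ZMod q) = ((1 : ℕ) : ZMod q) := by
      have := congrArg Units.val h
      push_cast
      simpa [u] using this
    rw [ZMod.natCast_eq_natCast_iff'] at h1
    have h2 : a ^ r ≤ a ^ K := Nat.pow_le_pow_right (by omega) hr.le
    rw [Nat.mod_eq_of_lt (by omega), Nat.mod_eq_of_lt (by omega)] at h1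
    have := Nat.one_lt_pow h0.ne' (show 1 < a by omega)
    omega
  have hlong : LongCyc σ K := by
    intro z hz hzK x h
    rw [hσz, mul_eq_right] at h
    apply hu z.natAbs (by omega) hzK
    rcases Int.natAbs_eq z with h' | h'
    · rw [h', zpow_natCast] at h; exact h
    · rw [h', zpow_neg, zpow_natCast, inv_eq_one] at h; exact h
  obtain ⟨D, rfl⟩ : ∃ D, q = D + 1 := ⟨q - 1, by omega⟩
  have : NeZero D := ⟨by omega⟩
  let τ : Equiv.Perm (ZMod D) := Equiv.addRight 1
  have hτ : ∀ (r : ℕ) x, (τ ^ r) x = x + r := by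
    intro r x
    simp [τ]
  have hτz : ∀ (z : ℤ) x, (τ ^ z) x = x + z := by
    intro r x
    simp [τ]
  have hlong' : LongCyc τ K := by
    intro z hz hzK x h
    rw [hτz, add_eq_left, ZMod.intCast_zmod_eq_zero_iff_dvd] at h
    have := Int.le_of_dvd (a := D) (b := |z|) (by positivity) ((dvd_abs _ _).2 h)
    rw [Int.abs_eq_natAbs] at this
    omega
  have e1 := hf _ σ hlong
  have e2 := hf _ τ hlong'
  have hc : Nat.card (ZMod (D+1))ˣ = D := by
    rw [Nat.card_eq_fintype_card, ZMod.card_units]; rfl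
  rw [hc] at e1
  rw [show Nat.card (ZMod D) = D by simp, ← e1] at e2
  have e3 : Sol τ (cons13 m (k+1)) =
      {x : Fin (k+1) → ZMod D | ∀ i j, i ≠ j → ∀ r : ℕ, r ≤ m → x i ≠ x j + r} := by
    ext x
    rw [mem_sol13]
    simp only [hτ, Set.mem_ofPred_eq]
  rw [e3, cycle_ncard m k D (by omega)] at e2
  have e4 : Set.ncard {x : Fin (k+1) → ZMod (D+1) | Function.Injective x ∧ (∀ i, x i ≠ 0) ∧
          ∀ i j, i ≠ j → ∀ r : ℕ, 1 ≤ r → r ≤ m →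
            x i ≠ (a : ZMod (D+1)) ^ r * x j} = (Sol σ (cons13 m (k+1))).ncard := by
    symm
    refine Set.ncard_congr (fun x _ => fun i => (x i : ZMod (D+1))) ?_ ?_ ?_
    · intro x hx
      rw [mem_sol13] at hx
      refine ⟨?_, fun i => (x i).ne_zero, ?_⟩
      · intro i j h
        by_contra hc
        exact hx i j hc 0 (by omega) (by simpa using Units.ext h)
      · intro i j hij r _ hr h
        refine hx i j hij r hr ?_
        rw [hσ]
        ext
        simpa [u] using h
    · intro x y _ _ h
      funext i
      exact Units.ext (congrFun h i)
    · rintro x ⟨hi, h0, hx⟩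
      refine ⟨fun i => Units.mk0 (x i) (h0 i), ?_, rfl⟩
      rw [mem_sol13]
      intro i j hij r hr h
      rw [hσ] at h
      have h := congrArg Units.val h
      simp only [Units.val_mk0, Units.val_mul, Units.val_pow_eq_pow_val, u] at h
      rcases Nat.eq_zero_or_pos r with rfl | h'
      · exact hij (hi (by simpa using h))
      · exact hx i j hij r h' hr h
  rw [e4, ← e2, Nat.descFactorial_eq_prod_range]
  push_cast
  congr 1
  · ring
  · rw [← Finset.Ico_add_one_right_eq_Icc, Finset.prod_Ico_eq_prod_range]
    refine Finset.prod_congr (by simp) ?_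
    intro j hj
    rw [Finset.mem_range] at hj
    rw [Nat.cast_sub (by omega), Nat.cast_sub (by omega), Nat.cast_sub (by omega)]
    push_cast
    ring
end

section
/- Let a ≥ 2 and n ≥ 1 be integers. Then there exists N such that for every prime q > N, the number of tuples (x_1,…,x_n) ∈ (ℤ/qℤ)^n whose coordinates are all nonzero and pairwise distinct and which satisfy x_i ≠ a·x_j for all pairs of indices with i < j, equals (q − 1)·(q − 1 − n)^{n−1}, computed in the integers. -/
open Classical in
/-- Configurations: injective tuples in `S` with `x i ≠ σ (x j)` for `i < j`. -/
noncomputable def cfg {α : Type} [Fintype α] (n : ℕ) (S : Finset α) (σ : Equiv.Perm α) :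
    Finset (Fin n → α) :=
  Finset.univ.filter fun x => (∀ i, x i ∈ S) ∧ Function.Injective x ∧
    ∀ i j, i < j → x i ≠ σ (x j)

theorem mem_cfg {α : Type} [Fintype α] {n : ℕ} {S : Finset α} {σ : Equiv.Perm α}
    {x : Fin n → α} : x ∈ cfg n S σ ↔ (∀ i, x i ∈ S) ∧ Function.Injective x ∧
    ∀ i j, i < j → x i ≠ σ (x j) := by
  classical
  simp [cfg]

theorem cfg_snoc {α : Type} [Fintype α] {n : ℕ} {S : Finset α} {σ : Equiv.Perm α}
    {x : Fin n → α} {z : α} : (Fin.snoc x z : Fin (n+1) → α) ∈ cfg (n+1) S σ ↔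
      z ∈ S ∧ (∀ i, x i ≠ z) ∧ (∀ i, x i ≠ σ z) ∧ x ∈ cfg n S σ := by
  rw [mem_cfg, mem_cfg, Fin.snoc_injective_iff]
  simp only [Fin.forall_fin_succ', Fin.snoc_castSucc, Fin.snoc_last, Set.mem_range,
    Fin.castSucc_lt_castSucc_iff, Fin.castSucc_lt_last, lt_irrefl, not_exists]
  constructor
  · rintro ⟨⟨h1, h2⟩, ⟨h3, h4⟩, h5, h6⟩
    exact ⟨h2, h4, fun i => (h5 i).2 trivial, h1, h3, fun i j => (h5 i).1 j⟩
  · rintro ⟨h2, h4, h5, h1, h3, h6⟩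
    refine ⟨⟨h1, h2⟩, ⟨h3, h4⟩, fun i => ⟨fun j => h6 i j, fun _ => h5 i⟩, ?_⟩
    refine ⟨fun i hi => absurd hi (by simp [Fin.le_last]), fun h => h.elim⟩

theorem cfg_cons {α : Type} [Fintype α] {n : ℕ} {S : Finset α} {σ : Equiv.Perm α}
    {x : Fin n → α} {z : α} : (Fin.cons z x : Fin (n+1) → α) ∈ cfg (n+1) S σ ↔
      z ∈ S ∧ (∀ i, x i ≠ z) ∧ (∀ i, z ≠ σ (x i)) ∧ x ∈ cfg n S σ := by
  rw [mem_cfg, mem_cfg, Fin.cons_injective_iff]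
  simp only [Fin.forall_fin_succ, Fin.cons_zero, Fin.cons_succ, Set.mem_range,
    Fin.succ_lt_succ_iff, Fin.succ_pos, lt_irrefl, not_exists]
  constructor
  · rintro ⟨⟨h1, h2⟩, ⟨h3, h4⟩, h5, h6⟩
    exact ⟨h1, h3, fun i => h5.2 i trivial, h2, h4, fun i j => (h6 i).2 j⟩
  · rintro ⟨h1, h3, h5, h2, h4, h6⟩
    refine ⟨⟨h1, h2⟩, ⟨h3, h4⟩, ⟨fun h => h.elim, fun i _ => h5 i⟩, fun i => ⟨?_, h6 i⟩⟩
    intro h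
    simp at h

open Classical in
theorem cfg_rot {α : Type} [Fintype α] {n : ℕ} {S : Finset α} {σ : Equiv.Perm α}
    (hS : ∀ y, σ y ∈ S ↔ y ∈ S) (i : Fin n) (z : α) :
    ((cfg (n+1) S σ).filter fun x => x i.castSucc = z).card =
    ((cfg (n+1) S σ).filter fun x => x i.succ = z).card := by
  have key : ∀ (x : Fin n → α) (y : α), (Fin.snoc x y : Fin (n+1) → α) ∈ cfg (n+1) S σ ↔
      (Fin.cons (σ y) x : Fin (n+1) → α) ∈ cfg (n+1) S σ := by
    intro x y
    rw [cfg_snoc, cfg_cons, hS]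
    simp only [ne_eq, σ.injective.eq_iff, eq_comm (a := y)]
    tauto
  refine Finset.card_bij' (fun x _ => (Fin.cons (σ (x (Fin.last n))) (Fin.init x) : Fin (n+1) → α))
    (fun x _ => (Fin.snoc (Fin.tail x) (σ.symm (x 0)) : Fin (n+1) → α)) ?_ ?_ ?_ ?_
  · intro x hx
    rw [Finset.mem_filter] at hx ⊢
    rw [← key, Fin.snoc_init_self]
    exact ⟨hx.1, by simpa [Fin.init] using hx.2⟩
  · intro x hx
    rw [Finset.mem_filter] at hx ⊢
    rw [key, Equiv.apply_symm_apply, Fin.cons_self_tail]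
    exact ⟨hx.1, by simpa [Fin.tail] using hx.2⟩
  · intro x hx
    simp
  · intro x hx
    simp

open Classical in
theorem cfg_last {α : Type} [Fintype α] {n : ℕ} {S : Finset α} {σ : Equiv.Perm α}
    (hS : ∀ y, σ y ∈ S ↔ y ∈ S) (i : Fin (n+1)) (z : α) :
    ((cfg (n+1) S σ).filter fun x => x i = z).card =
    ((cfg (n+1) S σ).filter fun x => x (Fin.last n) = z).card := by
  induction i using Fin.reverseInduction with
  | last => rfl
  | cast i ih => rw [cfg_rot hS, ih]

open Classical in
theorem cfg_contract {α : Type} [Fintype α] {n : ℕ} {S : Finset α} {σ : Equiv.Perm α}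
    (z : α) (hz : z ∈ S) :
    ((cfg (n+1) S σ).filter fun x => x (Fin.last n) = z).card =
    ((cfg n (S.erase z) (Equiv.swap z (σ z) * σ)).filter fun x => ∀ i, x i ≠ σ z).card := by
  have key : ∀ (x : Fin n → α), (Fin.snoc x z : Fin (n+1) → α) ∈ cfg (n+1) S σ ↔
      x ∈ (cfg n (S.erase z) (Equiv.swap z (σ z) * σ)).filter fun x => ∀ i, x i ≠ σ z := by
    intro x
    rw [cfg_snoc, Finset.mem_filter, mem_cfg, mem_cfg]
    simp only [Finset.mem_erase, Equiv.Perm.mul_apply]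
    have aux : (∀ i, x i ≠ z) → (∀ i, x i ≠ σ z) → ∀ i j,
        (x i ≠ Equiv.swap z (σ z) (σ (x j)) ↔ x i ≠ σ (x j)) := by
      intro h1 h2 i j
      by_cases h : σ (x j) = z
      · rw [h, Equiv.swap_apply_left]
        simp [h1, h2]
      · rw [Equiv.swap_apply_of_ne_of_ne h]
        exact fun e => h1 j (σ.injective e)
    constructor
    · rintro ⟨_, h1, h2, h3, h4, h5⟩
      exact ⟨⟨fun i => ⟨h1 i, h3 i⟩, h4, fun i j hij => (aux h1 h2 i j).2 (h5 i j hij)⟩, h2⟩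
    · rintro ⟨⟨h1, h4, h5⟩, h2⟩
      exact ⟨hz, fun i => (h1 i).1, h2, fun i => (h1 i).2, h4,
        fun i j hij => (aux (fun i => (h1 i).1) h2 i j).1 (h5 i j hij)⟩
  refine Finset.card_bij' (fun x _ => Fin.init x)
    (fun x _ => (Fin.snoc x z : Fin (n+1) → α)) ?_ ?_ ?_ ?_
  · intro x hx
    rw [Finset.mem_filter] at hx
    rw [← key, ← hx.2, Fin.snoc_init_self]
    exact hx.1
  · intro x hx
    rw [Finset.mem_filter, key]
    exact ⟨hx, by simp⟩
  · intro x hx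
    rw [Finset.mem_filter] at hx
    simp only [← hx.2, Fin.snoc_init_self]
  · intro x hx
    simp

open Classical in
theorem cfg_total {α : Type} [Fintype α] {n : ℕ} {S : Finset α} {σ : Equiv.Perm α} :
    (cfg (n+1) S σ).card = ∑ z ∈ S, ((cfg (n+1) S σ).filter fun x => x 0 = z).card :=
  Finset.card_eq_sum_card_fiberwise (s := cfg (n+1) S σ) (t := S) (f := fun x : Fin (n+1) → α => x 0) (fun x hx => (mem_cfg.1 hx).1 0)

open Classical in
theorem cfg_avoid {α : Type} [Fintype α] {n : ℕ} {S : Finset α} {σ : Equiv.Perm α} (w : α) :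
    (cfg n S σ).card = ((cfg n S σ).filter fun x => ∀ i, x i ≠ w).card +
      ∑ i, ((cfg n S σ).filter fun x => x i = w).card := by
  rw [← Finset.card_filter_add_card_filter_not (s := cfg n S σ) (fun x => ∀ i, x i ≠ w)]
  congr 1
  rw [← Finset.card_biUnion]
  · congr 1
    ext x
    simp
  · intro i _ j _ hij
    rw [Function.onFun, Finset.disjoint_left]
    intro x hx hx'
    rw [Finset.mem_filter] at hx hx'
    exact hij ((mem_cfg.1 hx.1).2.1 (hx.2.trans hx'.2.symm))

open Classical in
theorem cfg_point {α : Type} [Fintype α] (n : ℕ) : ∀ (S : Finset α) (σ : Equiv.Perm α),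
    (∀ y, σ y ∈ S ↔ y ∈ S) →
    (∀ T ⊆ S, T.Nonempty → (∀ y ∈ T, σ y ∈ T) → n + 1 ≤ T.card) →
    ∀ (i : Fin (n+1)), ∀ z ∈ S,
    (((cfg (n+1) S σ).filter fun x => x i = z).card : ℤ) = ((S.card : ℤ) - (n + 1)) ^ n := by
  induction n with
  | zero =>
    intro S σ hS hT i z hz
    rw [cfg_last hS, cfg_contract z hz]
    have : ((cfg 0 (S.erase z) (Equiv.swap z (σ z) * σ)).filter fun x => ∀ i, x i ≠ σ z)
        = Finset.univ := by
      ext x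
      simp only [Finset.mem_filter, mem_cfg, Finset.mem_univ, iff_true]
      exact ⟨⟨fun i => i.elim0, fun i => i.elim0, fun i => i.elim0⟩, fun i => i.elim0⟩
    rw [this]
    simp
  | succ n ih =>
    intro S σ hS hT i z hz
    have hσz : σ z ≠ z := by
      intro h
      have := hT {z} (by simpa using hz) (by simp) (by simp [h])
      simp at this
    rw [cfg_last hS, cfg_contract z hz]
    set τ := Equiv.swap z (σ z) * σ with hτ
    have τ1 : ∀ y, σ y = z → τ y = σ z := by
      intro y h
      simp [hτ, h]
    have τ2 : τ z = z := by simp [hτ]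
    have τ3 : ∀ y, y ≠ z → σ y ≠ z → τ y = σ y := by
      intro y h h'
      rw [hτ, Equiv.Perm.mul_apply, Equiv.swap_apply_of_ne_of_ne h']
      exact fun e => h (σ.injective e)
    have hS' : ∀ y, τ y ∈ S.erase z ↔ y ∈ S.erase z := by
      intro y
      by_cases h : y = z
      · rw [h, τ2]
      by_cases h' : σ y = z
      · rw [τ1 y h']
        have : y ∈ S := (hS y).1 (h' ▸ hz)
        simp [hσz, h, this, hS, hz]
      · rw [τ3 y h h']
        simp [h, h', hS]
    have hT' : ∀ T ⊆ S.erase z, T.Nonempty → (∀ y ∈ T, τ y ∈ T) → n + 1 ≤ T.card := by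
      intro T hTS hne hinv
      have hzT : z ∉ T := fun h => by simpa using hTS h
      have hTS' : T ⊆ S := hTS.trans (Finset.erase_subset _ _)
      by_cases hp : ∃ y ∈ T, σ y = z
      · obtain ⟨p, hpT, hp⟩ := hp
        have := hT (insert z T) (Finset.insert_subset hz hTS') (by simp) (by
          intro y hy
          rcases Finset.mem_insert.1 hy with rfl | hy
          · rw [← τ1 p hp]
            exact Finset.mem_insert_of_mem (hinv p hpT)
          · by_cases h : σ y = z
            · simp [h]
            · rw [← τ3 y (fun e => hzT (e ▸ hy)) h]
              exact Finset.mem_insert_of_mem (hinv y hy))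
        rw [Finset.card_insert_of_notMem hzT] at this
        omega
      · push Not at hp
        have := hT T hTS' hne (by
          intro y hy
          rw [← τ3 y (fun e => hzT (e ▸ hy)) (hp y hy)]
          exact hinv y hy)
        omega
    have IH := ih (S.erase z) τ hS' hT'
    have e1 := cfg_avoid (n := n+1) (S := S.erase z) (σ := τ) (σ z)
    have e2 := cfg_total (n := n) (S := S.erase z) (σ := τ)
    rw [e2] at e1
    have hc : ((S.erase z).card : ℤ) = (S.card : ℤ) - 1 := by
      rw [← Finset.card_erase_add_one hz]
      push_cast
      ring
    have e3 : ((S.erase z).card : ℤ) * (((S.erase z).card : ℤ) - (n+1))^n =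
        (((cfg (n+1) (S.erase z) τ).filter fun x => ∀ i, x i ≠ σ z).card : ℤ) +
        (n+1) * (((S.erase z).card : ℤ) - (n+1))^n := by
      have e1' := congrArg (Nat.cast (R := ℤ)) e1
      push_cast at e1'
      rw [Finset.sum_congr rfl (fun w hw => IH 0 w hw),
        Finset.sum_congr rfl (fun i _ => IH i (σ z) (by simp [hσz, hS, hz]))] at e1'
      simpa using e1'
    rw [hc] at e3
    push_cast
    rw [pow_succ]
    have : ((S.card : ℤ) - (n + 1 + 1)) = (S.card : ℤ) - 1 - (n+1) := by ring
    rw [this]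
    linarith

theorem stmt_14 (a n : ℕ) (ha : 2 ≤ a) (hn : 1 ≤ n) :
    ∃ N : ℕ, ∀ q : ℕ, q.Prime → N < q →
      (Set.ncard {x : Fin n → ZMod q | Function.Injective x ∧ (∀ i, x i ≠ 0) ∧
          ∀ i j : Fin n, i < j → x i ≠ (a : ZMod q) * x j} : ℤ) =
        ((q : ℤ) - 1) * ((q : ℤ) - 1 - n) ^ (n - 1) := by
  classical
  refine ⟨a ^ n, fun q hq hN => ?_⟩
  haveI : Fact q.Prime := ⟨hq⟩
  obtain ⟨m, rfl⟩ : ∃ m, n = m + 1 := ⟨n - 1, by omega⟩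
  have hinj : ∀ i j, i ≤ m → j ≤ m → (a : ZMod q) ^ i = (a : ZMod q) ^ j → i = j := by
    intro i j hi hj h
    have hlt : ∀ k, k ≤ m → a ^ k < q := fun k hk =>
      lt_of_le_of_lt (Nat.pow_le_pow_right (by omega) (by omega)) hN
    have h' : ((a ^ i : ℕ) : ZMod q) = ((a ^ j : ℕ) : ZMod q) := by push_cast; exact h
    rw [ZMod.natCast_eq_natCast_iff] at h'
    exact Nat.pow_right_injective ha (Nat.ModEq.eq_of_lt_of_lt h' (hlt i hi) (hlt j hj))
  have ha0 : (a : ZMod q) ≠ 0 := by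
    intro h
    rw [ZMod.natCast_eq_zero_iff] at h
    have h1 := Nat.le_of_dvd (by omega) h
    have h2 : a ^ 1 ≤ a ^ (m+1) := Nat.pow_le_pow_right (by omega) (by omega)
    simp at h2
    omega
  set σ : Equiv.Perm (ZMod q) := Equiv.mulLeft₀ (a : ZMod q) ha0 with hσ
  set S : Finset (ZMod q) := Finset.univ.erase 0 with hSdef
  have hS : ∀ y, σ y ∈ S ↔ y ∈ S := by
    intro y
    simp [hσ, hSdef, ha0]
  have hT : ∀ T ⊆ S, T.Nonempty → (∀ y ∈ T, σ y ∈ T) → m + 1 ≤ T.card := by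
    rintro T hTS ⟨y, hy⟩ hinv
    have hy0 : y ≠ 0 := by simpa [hSdef] using hTS hy
    have hmem : ∀ k, (a : ZMod q) ^ k * y ∈ T := by
      intro k
      induction k with
      | zero => simpa using hy
      | succ k ih =>
        have := hinv _ ih
        simpa [hσ, pow_succ', mul_assoc] using this
    rw [← Finset.card_range (m+1)]
    refine Finset.card_le_card_of_injOn (fun k => (a : ZMod q) ^ k * y) (fun k _ => hmem k) ?_
    intro i hi j hj h
    simp only [Finset.coe_range, Set.mem_Iio] at hi hj
    exact hinj i j (by omega) (by omega) (mul_right_cancel₀ hy0 h)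
  have hcard : (S.card : ℤ) = (q : ℤ) - 1 := by
    have := Finset.card_erase_add_one (Finset.mem_univ (0 : ZMod q))
    rw [Finset.card_univ, ZMod.card] at this
    have h2 : S.card + 1 = q := this
    omega
  have hset : {x : Fin (m+1) → ZMod q | Function.Injective x ∧ (∀ i, x i ≠ 0) ∧
          ∀ i j : Fin (m+1), i < j → x i ≠ (a : ZMod q) * x j} = ↑(cfg (m+1) S σ) := by
    ext x
    simp only [Set.mem_setOf_eq, Finset.mem_coe, mem_cfg]
    simp [hσ, hSdef]
    tauto
  rw [hset, Set.ncard_coe_finset, cfg_total]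
  push_cast
  rw [Finset.sum_congr rfl (fun w hw => cfg_point m S σ hS hT 0 w hw)]
  simp [hcard]
end

section
/- Let k ≥ 3 and n ≥ 1 be integers and let C_k denote the cycle graph on k vertices. Then n times the number of n-element independent sets of C_k equals k · binom(k − n − 1, n − 1), where binom denotes the usual binomial coefficient of natural numbers and subtraction is truncated subtraction of natural numbers. -/
/-- The cycle graph on `ℤ/kℤ`: distinct `i, j` are adjacent iff `i - j = 1` or
`j - i = 1` in `ℤ/kℤ`. -/
def cycleGraph (k : ℕ) : SimpleGraph (ZMod k) :=
  SimpleGraph.fromRel (fun i j => i - j = 1)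

def pathSets (m r : ℕ) : Finset (Finset ℕ) :=
  ((Finset.range m).powersetCard r).filter (fun S => ∀ i ∈ S, i + 1 ∉ S)

lemma mem_pathSets {m r : ℕ} {S : Finset ℕ} :
    S ∈ pathSets m r ↔ ((∀ i ∈ S, i < m) ∧ S.card = r) ∧ ∀ i ∈ S, i + 1 ∉ S := by
  simp [pathSets, Finset.mem_powersetCard, Finset.subset_iff]

lemma pathSets_rec (m r : ℕ) :
    (pathSets (m + 2) (r + 1)).card = (pathSets (m + 1) (r + 1)).card + (pathSets m r).card := by
  rw [← Finset.card_filter_add_card_filter_not (s := pathSets (m + 2) (r + 1))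
    (fun S => m + 1 ∉ S)]
  congr 1
  · congr 1
    ext S
    simp only [Finset.mem_filter, mem_pathSets]
    constructor
    · rintro ⟨⟨⟨h1, h2⟩, h3⟩, h4⟩
      refine ⟨⟨fun i hi => ?_, h2⟩, h3⟩
      have := h1 i hi
      have : i ≠ m + 1 := fun h => h4 (h ▸ hi)
      omega
    · rintro ⟨⟨h1, h2⟩, h3⟩
      refine ⟨⟨⟨fun i hi => ?_, h2⟩, h3⟩, fun h => ?_⟩
      · have := h1 i hi
        omega
      · have := h1 _ h
        omega
  · refine Finset.card_bij' (fun S _ => S.erase (m + 1)) (fun S _ => insert (m + 1) S) ?_ ?_ ?_ ?_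
    · intro S hS
      simp only [Finset.mem_filter, mem_pathSets, not_not] at hS ⊢
      obtain ⟨⟨⟨h1, h2⟩, h3⟩, h4⟩ := hS
      refine ⟨⟨fun i hi => ?_, ?_⟩, fun i hi hi' => ?_⟩
      · rw [Finset.mem_erase] at hi
        have := h1 i hi.2
        have : i ≠ m := fun h => h3 i hi.2 (h ▸ h4)
        omega
      · rw [Finset.card_erase_of_mem h4, h2]; rfl
      · exact h3 i (Finset.mem_of_mem_erase hi) (Finset.mem_of_mem_erase hi')
    · intro S hS
      simp only [Finset.mem_filter, mem_pathSets, not_not] at hS ⊢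
      obtain ⟨⟨h1, h2⟩, h3⟩ := hS
      have h4 : m + 1 ∉ S := fun h => by have := h1 _ h; omega
      refine ⟨⟨⟨fun i hi => ?_, ?_⟩, fun i hi hi' => ?_⟩, Finset.mem_insert_self _ _⟩
      · rcases Finset.mem_insert.1 hi with h | h
        · omega
        · have := h1 i h
          omega
      · rw [Finset.card_insert_of_notMem h4, h2]
      · rcases Finset.mem_insert.1 hi with h | h <;> rcases Finset.mem_insert.1 hi' with h' | h'
        · omega
        · have := h1 _ h'
          omega
        · have := h1 _ h
          omega
        · exact h3 i h h'
    · intro S hS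
      simp only [Finset.mem_filter, not_not] at hS
      exact Finset.insert_erase hS.2
    · intro S hS
      rw [mem_pathSets] at hS
      exact Finset.erase_insert (fun h => by have := hS.1.1 _ h; omega)

lemma pathSets_card (m r : ℕ) : (pathSets m r).card = Nat.choose (m + 1 - r) r := by
  induction m using Nat.strong_induction_on generalizing r with
  | _ m ih =>
    rcases r with _ | r
    · have : pathSets m 0 = {∅} := by
        ext S
        rw [mem_pathSets, Finset.mem_singleton]
        constructor
        · rintro ⟨⟨_, h⟩, _⟩
          exact Finset.card_eq_zero.1 h
        · rintro rfl
          simp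
      simp [this]
    · match m, ih with
      | 0, _ =>
        have : pathSets 0 (r + 1) = ∅ := by
          rw [pathSets, Finset.powersetCard_eq_empty.2 (by simp)]
          rfl
        simp [this]
      | 1, _ =>
        rcases r with _ | r
        · decide
        · have : pathSets 1 (r + 1 + 1) = ∅ := by
            rw [pathSets, Finset.powersetCard_eq_empty.2 (by simp)]
            rfl
          rw [this]
          simp
      | m + 2, ih =>
        rw [pathSets_rec, ih _ (by omega), ih _ (by omega)]
        rcases Nat.lt_or_ge (m + 1) r with h | h
        · rw [Nat.choose_eq_zero_of_lt, Nat.choose_eq_zero_of_lt, Nat.choose_eq_zero_of_lt] <;> omega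
        · have e1 : m + 2 + 1 - (r + 1) = (m + 1 - r) + 1 := by omega
          have e2 : m + 1 + 1 - (r + 1) = m + 1 - r := by omega
          rw [e1, e2, Nat.choose_succ_succ, add_comm]

lemma indep_iff (m : ℕ) (S : Finset (ZMod (m + 3))) :
    (∀ u ∈ S, ∀ v ∈ S, ¬ (cycleGraph (m + 3)).Adj u v) ↔ ∀ u ∈ S, u + 1 ∉ S := by
  have : Fact (1 < m + 3) := ⟨by omega⟩
  simp only [cycleGraph, SimpleGraph.fromRel_adj]
  constructor
  · intro h u hu hu'
    refine h u hu _ hu' ⟨?_, Or.inr (by ring)⟩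
    intro h
    exact one_ne_zero (α := ZMod (m + 3)) (by simpa using h)
  · rintro h u hu v hv ⟨_, h' | h'⟩
    · exact h v hv (by rwa [← h', add_sub_cancel])
    · exact h u hu (by rwa [← h', add_sub_cancel])

def cycSets (m n : ℕ) : Finset (Finset (ZMod (m + 3))) :=
  Finset.univ.filter (fun S => S.card = n ∧ ∀ u ∈ S, u + 1 ∉ S)

lemma mem_cycSets {m n : ℕ} {S : Finset (ZMod (m + 3))} :
    S ∈ cycSets m n ↔ S.card = n ∧ ∀ u ∈ S, u + 1 ∉ S := by
  simp [cycSets]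

lemma cyc_shift (m n : ℕ) (a : ZMod (m + 3)) :
    ((cycSets m n).filter (fun S => a ∈ S)).card =
      ((cycSets m n).filter (fun S => 0 ∈ S)).card := by
  refine Finset.card_bij' (fun S _ => S.map (Equiv.subRight a).toEmbedding)
    (fun S _ => S.map (Equiv.addRight a).toEmbedding) ?_ ?_ ?_ ?_
  · intro S hS
    simp only [Finset.mem_filter, mem_cycSets, Finset.card_map] at hS ⊢
    refine ⟨⟨hS.1.1, ?_⟩, ?_⟩
    · intro u hu hu'
      simp only [Finset.mem_map_equiv, Equiv.subRight_symm_apply] at hu hu'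
      exact hS.1.2 _ hu (by rwa [add_right_comm] at hu')
    · simpa [Finset.mem_map_equiv] using hS.2
  · intro S hS
    simp only [Finset.mem_filter, mem_cycSets, Finset.card_map] at hS ⊢
    refine ⟨⟨hS.1.1, ?_⟩, ?_⟩
    · intro u hu hu'
      simp only [Finset.mem_map_equiv, Equiv.addRight_symm, Equiv.coe_addRight] at hu hu'
      exact hS.1.2 _ hu (by rwa [add_right_comm] at hu')
    · simpa [Finset.mem_map_equiv] using hS.2
  · intro S _
    ext x
    simp [Finset.mem_map_equiv]
  · intro S _
    ext x
    simp [Finset.mem_map_equiv]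

lemma cast_inj_lt {k i j : ℕ} (hi : i < k) (hj : j < k) (h : (i : ZMod k) = j) : i = j := by
  have := (ZMod.natCast_eq_natCast_iff' i j k).1 h
  rwa [Nat.mod_eq_of_lt hi, Nat.mod_eq_of_lt hj] at this

lemma exists_cast (m : ℕ) (x : ZMod (m + 3)) : ∃ i : ℕ, i < m + 3 ∧ (i : ZMod (m + 3)) = x :=
  ⟨x.val, ZMod.val_lt x, ZMod.natCast_zmod_val x⟩

lemma last_add (m : ℕ) : ((m + 2 : ℕ) : ZMod (m + 3)) + 1 = 0 := by
  have := ZMod.natCast_self (m + 3)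
  push_cast at this ⊢
  rw [← this]; ring

/-- lift of a path set -/
def liftSet (m : ℕ) (T : Finset ℕ) : Finset (ZMod (m + 3)) :=
  insert 0 (T.image (fun i => ((i + 2 : ℕ) : ZMod (m + 3))))

lemma cast_mem_liftSet {m : ℕ} {T : Finset ℕ} (hT : ∀ i ∈ T, i < m) {j : ℕ} (hj : j < m + 3) :
    (j : ZMod (m + 3)) ∈ liftSet m T ↔ j = 0 ∨ ∃ i ∈ T, i + 2 = j := by
  rw [liftSet, Finset.mem_insert, Finset.mem_image]
  refine or_congr ⟨fun h => ?_, fun h => by simp [h]⟩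
    (exists_congr fun i => and_congr_right fun hi => ⟨fun h => ?_, fun h => by rw [h]⟩)
  · exact cast_inj_lt hj (by omega) (by simpa using h)
  · have := hT i hi
    exact cast_inj_lt (by omega) hj h

lemma cyc_zero (m r : ℕ) :
    ((cycSets m (r + 1)).filter (fun S => 0 ∈ S)).card = (pathSets m r).card := by
  symm
  refine Finset.card_bij (fun T _ => liftSet m T) ?_ ?_ ?_
  · intro T hT
    obtain ⟨⟨h1, h2⟩, h3⟩ := mem_pathSets.1 hT
    rw [Finset.mem_filter, mem_cycSets]
    refine ⟨⟨?_, ?_⟩, Finset.mem_insert_self _ _⟩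
    · rw [liftSet, Finset.card_insert_of_notMem, Finset.card_image_of_injOn, h2]
      · intro i hi j hj hij
        have := h1 i hi
        have := h1 j hj
        have := cast_inj_lt (by omega) (by omega) hij
        omega
      · intro h
        obtain ⟨i, hi, h⟩ := Finset.mem_image.1 h
        have := h1 i hi
        have := cast_inj_lt (k := m + 3) (i := i + 2) (j := 0) (by omega) (by omega) (by simpa using h)
        omega
    · intro u hu hu'
      obtain ⟨j, hj, rfl⟩ := exists_cast m u
      rw [cast_mem_liftSet h1 hj] at hu
      have hj2 : j < m + 2 := by
        rcases hu with h | ⟨i, hi, h⟩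
        · omega
        · have := h1 i hi
          omega
      have hu2 : ((j + 1 : ℕ) : ZMod (m + 3)) ∈ liftSet m T := by simpa using hu'
      rw [cast_mem_liftSet h1 (by omega)] at hu2
      rcases hu2 with h | ⟨i', hi', h'⟩
      · omega
      rcases hu with h | ⟨i, hi, h⟩
      · omega
      · apply h3 i hi
        have : i' = i + 1 := by omega
        exact this ▸ hi'
  · intro T hT T' hT' h
    have h1 := (mem_pathSets.1 hT).1.1
    have h1' := (mem_pathSets.1 hT').1.1
    have key : ∀ A B : Finset ℕ, (∀ i ∈ A, i < m) → (∀ i ∈ B, i < m) →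
        liftSet m A = liftSet m B → A ⊆ B := by
      intro A B hA hB hAB i hi
      have := hA i hi
      have h2 := (cast_mem_liftSet hA (j := i + 2) (by omega)).2 (Or.inr ⟨i, hi, rfl⟩)
      rw [hAB, cast_mem_liftSet hB (by omega)] at h2
      rcases h2 with h | ⟨i', hi', h'⟩
      · omega
      · have : i' = i := by omega
        exact this ▸ hi'
    exact (key _ _ h1 h1' h).antisymm (key _ _ h1' h1 h.symm)
  · intro S hS
    rw [Finset.mem_filter, mem_cycSets] at hS
    obtain ⟨⟨h1, h2⟩, h3⟩ := hS
    let T := (Finset.range m).filter (fun i => ((i + 2 : ℕ) : ZMod (m + 3)) ∈ S)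
    have hTm : ∀ i ∈ T, i < m := fun i hi => Finset.mem_range.1 (Finset.mem_filter.1 hi).1
    have hlift : liftSet m T = S := by
      ext x
      obtain ⟨j, hj, rfl⟩ := exists_cast m x
      rw [cast_mem_liftSet hTm hj]
      constructor
      · rintro (rfl | ⟨i, hi, rfl⟩)
        · simpa using h3
        · exact (Finset.mem_filter.1 hi).2
      · intro hjS
        by_cases h0 : j = 0
        · exact Or.inl h0
        right
        have hj1 : j ≠ 1 := by
          rintro rfl
          exact h2 0 h3 (by simpa using hjS)
        have hj2 : j ≠ m + 2 := by
          rintro rfl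
          exact h2 _ hjS (by rwa [last_add])
        refine ⟨j - 2, Finset.mem_filter.2 ⟨Finset.mem_range.2 (by omega), ?_⟩, by omega⟩
        rwa [show j - 2 + 2 = j by omega]
    refine ⟨T, mem_pathSets.2 ⟨⟨hTm, ?_⟩, ?_⟩, hlift⟩
    · have : (liftSet m T).card = T.card + 1 := by
        rw [liftSet, Finset.card_insert_of_notMem, Finset.card_image_of_injOn]
        · intro i hi j hj hij
          have := hTm i hi
          have := hTm j hj
          have := cast_inj_lt (by omega) (by omega) hij
          omega
        · intro h
          obtain ⟨i, hi, h⟩ := Finset.mem_image.1 h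
          have := hTm i hi
          have := cast_inj_lt (k := m + 3) (i := i + 2) (j := 0) (by omega) (by omega)
            (by simpa using h)
          omega
      rw [hlift, h1] at this
      omega
    · intro i hi hi'
      refine h2 _ (Finset.mem_filter.1 hi).2 ?_
      have := (Finset.mem_filter.1 hi').2
      rw [show i + 1 + 2 = (i + 2) + 1 by ring, Nat.cast_add_one] at this
      exact this

theorem stmt_16 (k n : ℕ) (hk : 3 ≤ k) (hn : 1 ≤ n) :
    n * indepCount (cycleGraph k) n = k * Nat.choose (k - n - 1) (n - 1) := by
  obtain ⟨m, rfl⟩ := Nat.exists_eq_add_of_le' hk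
  obtain ⟨r, rfl⟩ := Nat.exists_eq_add_of_le' hn
  have h1 : indepCount (cycleGraph (m + 3)) (r + 1) = (cycSets m (r + 1)).card := by
    rw [indepCount, ← Set.ncard_coe_finset]
    congr 1
    ext S
    rw [Set.mem_setOf_eq, indep_iff, Finset.mem_coe, mem_cycSets]
  have h2 := Finset.sum_card (B := cycSets m (r + 1)) (n := (pathSets m r).card)
    (fun a => by rw [cyc_shift, cyc_zero])
  rw [Finset.sum_congr rfl (fun S hS => (mem_cycSets.1 hS).1), Finset.sum_const, smul_eq_mul,
    ZMod.card, pathSets_card] at h2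
  rw [h1, mul_comm, h2]
  congr 2
  omega
end
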